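/- Let (π, u, H) be a covariant representation of (A, G, α) with π faithful, and suppose there exists a bounded linear map E from the C*-algebra generated by {π(a(g))u_g} onto A such that E(π(a)) = a for all a ∈ A and E(π(d)u_g) = 0 for all g ≠ e, d ∈ D_g. Then π × u possesses property (*): ‖Σ_{g∈F} π(a(g)) u_g‖ ≥ ‖a(e)‖ for all finite F, and E coincides with the canonical conditional expectation N determined by N(Σ π(a(g))u_g) = a(e). -/

import Mathlib

noncomputable section

/-- A partial action of a discrete group `G` on a (C*-)algebra `A`: a family of closed
two-sided (star-closed) ideals `D g` together with *-isomorphisms `α g : D g⁻¹ ≃ D g`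
satisfying `α g (D g⁻¹ ∩ D h) ⊆ D (g h)`, `α (h g) = α h ∘ α g` on the appropriate domain,
`D 1 = A` and `α 1 = id`. -/
structure PartialAction (G : Type) [Group G] (A : Type) [NonUnitalNormedRing A]
    [StarRing A] [NormedSpace ℂ A] [IsScalarTower ℂ A A] [SMulCommClass ℂ A A]
    [StarModule ℂ A] where
  D : G → NonUnitalStarSubalgebra ℂ A
  closed : ∀ g, IsClosed (D g : Set A)
  idealL : ∀ g, ∀ a : A, ∀ d ∈ D g, a * d ∈ D g
  idealR : ∀ g, ∀ a : A, ∀ d ∈ D g, d * a ∈ D g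
  α : ∀ g : G, ↥(D g⁻¹) ≃⋆ₐ[ℂ] ↥(D g)
  D_one : D (1 : G) = ⊤
  α_one : ∀ d : ↥(D (1 : G)⁻¹), ((α 1 d : A)) = (d : A)
  mapsInto : ∀ g h : G, ∀ d : ↥(D g⁻¹), (d : A) ∈ D h → ((α g d : A)) ∈ D (g * h)
  comp : ∀ h g : G, ∀ d : ↥(D g⁻¹), ∀ hd : (d : A) ∈ D ((h * g)⁻¹),
    ∀ hd2 : ((α g d : A)) ∈ D h⁻¹,
    ((α (h * g) ⟨(d : A), hd⟩ : A)) = ((α h ⟨(α g d : A), hd2⟩ : A))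

open ContinuousLinearMap in
/-- A covariant representation `(π, u, H)` of a partial dynamical system `(A, G, α)`:
`π` is a *-representation of `A` on the Hilbert space `H` and each `u g` is a partial
isometry with initial space `[π(D_{g⁻¹})H]` and final space `[π(D_g)H]`, satisfying
`u_g π(d) u_{g⁻¹} = π(α_g(d))`, `π(d)(u_g u_h - u_{gh}) = 0` and `u_g* = u_{g⁻¹}`. -/
structure CovariantRep {G : Type} [Group G] {A : Type} [NonUnitalNormedRing A]
    [StarRing A] [NormedSpace ℂ A] [IsScalarTower ℂ A A] [SMulCommClass ℂ A A]
    [StarModule ℂ A] (θ : PartialAction G A)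
    (H : Type) [NormedAddCommGroup H] [InnerProductSpace ℂ H] [CompleteSpace H] where
  π : A →⋆ₙₐ[ℂ] (H →L[ℂ] H)
  u : G → (H →L[ℂ] H)
  u_adj : ∀ g : G, adjoint (u g) = u g⁻¹
  partialIsometry : ∀ g : G, u g ∘L (u g⁻¹ ∘L u g) = u g
  initial : ∀ (g : G) (ξ : H), (u g⁻¹ ∘L u g) ξ = ξ ↔
    ξ ∈ closure (Submodule.span ℂ {v : H | ∃ d ∈ θ.D g⁻¹, ∃ w : H, v = π d w} : Set H)
  final : ∀ (g : G) (ξ : H), (u g ∘L u g⁻¹) ξ = ξ ↔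
    ξ ∈ closure (Submodule.span ℂ {v : H | ∃ d ∈ θ.D g, ∃ w : H, v = π d w} : Set H)
  covar : ∀ (g : G) (d : ↥(θ.D g⁻¹)),
    u g ∘L (π (d : A) ∘L u g⁻¹) = π ((θ.α g d : A))
  covar2 : ∀ (g h : G) (d : A), d ∈ θ.D g → d ∈ θ.D (g * h) →
    π d ∘L (u g ∘L u h - u (g * h)) = 0

/-- The C*-algebra generated by the image of a covariant representation `(π, u, H)`
(i.e. by `(π × u)(L)` together with the partial isometries `u_g`). -/
def CovariantRep.genAlg {G : Type} [Group G] {A : Type} [NonUnitalNormedRing A]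
    [StarRing A] [NormedSpace ℂ A] [IsScalarTower ℂ A A] [SMulCommClass ℂ A A]
    [StarModule ℂ A] {θ : PartialAction G A}
    {H : Type} [NormedAddCommGroup H] [InnerProductSpace ℂ H] [CompleteSpace H]
    (ρ : CovariantRep θ H) : StarSubalgebra ℂ (H →L[ℂ] H) :=
  (StarAlgebra.adjoin ℂ (Set.range (fun a : A => ρ.π a) ∪ Set.range ρ.u)).topologicalClosure

variable {G : Type} [Group G] {A : Type} [NonUnitalNormedRing A]
  [StarRing A] [NormedSpace ℂ A] [IsScalarTower ℂ A A] [SMulCommClass ℂ A A]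
  [StarModule ℂ A] {θ : PartialAction G A}
  {H : Type} [NormedAddCommGroup H] [InnerProductSpace ℂ H] [CompleteSpace H]

lemma CovariantRep.pi_mem_genAlg (ρ : CovariantRep θ H) (a : A) : ρ.π a ∈ ρ.genAlg :=
  (StarSubalgebra.le_topologicalClosure _)
    (StarAlgebra.subset_adjoin ℂ _ (Or.inl ⟨a, rfl⟩))

lemma CovariantRep.u_mem_genAlg (ρ : CovariantRep θ H) (g : G) : ρ.u g ∈ ρ.genAlg :=
  (StarSubalgebra.le_topologicalClosure _)
    (StarAlgebra.subset_adjoin ℂ _ (Or.inr ⟨g, rfl⟩))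

lemma CovariantRep.u_u_pi (ρ : CovariantRep θ H) (g : G) (d : A) (hd : d ∈ θ.D g) :
    ρ.u g * (ρ.u g⁻¹ * ρ.π d) = ρ.π d := by
  ext ξ
  exact (ρ.final g (ρ.π d ξ)).2 (subset_closure (Submodule.subset_span ⟨d, hd, ξ, rfl⟩))

lemma CovariantRep.star_u (ρ : CovariantRep θ H) (g : G) : star (ρ.u g) = ρ.u g⁻¹ := by
  rw [ContinuousLinearMap.star_eq_adjoint, ρ.u_adj]

lemma CovariantRep.pi_u_u (ρ : CovariantRep θ H) (g : G) (d : A) (hd : d ∈ θ.D g) :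
    ρ.π d * (ρ.u g * ρ.u g⁻¹) = ρ.π d := by
  have h := congrArg star (ρ.u_u_pi g (star d) (star_mem hd))
  simpa [star_mul, ρ.star_u, map_star, mul_assoc] using h

lemma CovariantRep.comm_u (ρ : CovariantRep θ H) (g : G) (c : A) (hc : c ∈ θ.D g⁻¹) :
    ∃ c' ∈ θ.D g, ρ.u g * ρ.π c = ρ.π c' * ρ.u g ∧ ∀ k, c ∈ θ.D k → c' ∈ θ.D (g * k) := by
  refine ⟨θ.α g ⟨c, hc⟩, (θ.α g ⟨c, hc⟩).2, ?_, fun k hk => θ.mapsInto g k ⟨c, hc⟩ hk⟩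
  have h1 : ρ.u g * (ρ.π c * ρ.u g⁻¹) = ρ.π (θ.α g ⟨c, hc⟩ : A) := ρ.covar g ⟨c, hc⟩
  have h2 := ρ.pi_u_u g⁻¹ c hc
  rw [inv_inv] at h2
  rw [← h1, mul_assoc, mul_assoc, h2]

lemma CovariantRep.comm_pi (ρ : CovariantRep θ H) (g : G) (d : A) (hd : d ∈ θ.D g) :
    ∃ d' ∈ θ.D g⁻¹, ρ.π d * ρ.u g = ρ.u g * ρ.π d' := by
  obtain ⟨c, hc, h, -⟩ := ρ.comm_u g⁻¹ (star d) (by rw [inv_inv]; exact star_mem hd)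
  refine ⟨star c, star_mem hc, ?_⟩
  have h' := congrArg star h
  simpa [star_mul, ρ.star_u, map_star] using h'

lemma CovariantRep.prod_form (ρ : CovariantRep θ H) (g h : G) (d c : A) (hd : d ∈ θ.D g)
    (hc : c ∈ θ.D h) :
    ∃ f ∈ θ.D (g * h⁻¹), (ρ.π d * ρ.u g) * star (ρ.π c * ρ.u h) = ρ.π f * ρ.u (g * h⁻¹) := by
  obtain ⟨d', hd', e1⟩ := ρ.comm_pi g d hd
  obtain ⟨c', hc', e2, -⟩ := ρ.comm_u h⁻¹ (star c) (by rw [inv_inv]; exact star_mem hc)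
  obtain ⟨f, hf, e3, hk⟩ := ρ.comm_u g (d' * c') (θ.idealR _ _ _ hd')
  have hf2 := hk h⁻¹ (θ.idealL _ _ _ hc')
  refine ⟨f, hf2, ?_⟩
  have e4 : ρ.π f * (ρ.u g * ρ.u h⁻¹ - ρ.u (g * h⁻¹)) = 0 := ρ.covar2 g h⁻¹ f hf hf2
  rw [mul_sub, sub_eq_zero] at e4
  rw [star_mul, ρ.star_u, ← map_star, e2, e1, ← e4, ← mul_assoc (ρ.π f), ← e3, map_mul]
  simp only [mul_assoc]

lemma CovariantRep.diag_form (ρ : CovariantRep θ H) (g : G) (d : A) (hd : d ∈ θ.D g) :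
    (ρ.π d * ρ.u g) * star (ρ.π d * ρ.u g) = ρ.π (d * star d) := by
  have h := ρ.pi_u_u g d hd
  rw [star_mul, ρ.star_u, ← map_star, map_mul, ← mul_assoc, mul_assoc (ρ.π d), h]

lemma CovariantRep.pi_u_one (ρ : CovariantRep θ H) (d : A) : ρ.π d * ρ.u 1 = ρ.π d := by
  have hd : d ∈ θ.D 1 := by rw [θ.D_one]; trivial
  have h1 := ρ.pi_u_u 1 d hd
  have h2 : ρ.π d * (ρ.u 1 * ρ.u 1 - ρ.u (1 * 1)) = 0 := ρ.covar2 1 1 d hd (by simpa using hd)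
  rw [inv_one] at h1
  rw [mul_sub, sub_eq_zero, h1, mul_one] at h2
  exact h2.symm

/-- The `g`-th fibre `π(D_g) u_g`. -/
def CovariantRep.fibre (ρ : CovariantRep θ H) (g : G) : Submodule ℂ ↥ρ.genAlg where
  carrier := {x | ∃ d ∈ θ.D g, (x : H →L[ℂ] H) = ρ.π d * ρ.u g}
  add_mem' := by
    rintro x y ⟨d, hd, hx⟩ ⟨c, hc, hy⟩
    exact ⟨d + c, add_mem hd hc, by simp [hx, hy, add_mul]⟩
  zero_mem' := ⟨0, zero_mem _, by simp⟩
  smul_mem' := by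
    rintro r x ⟨d, hd, hx⟩
    exact ⟨r • d, SMulMemClass.smul_mem r hd, by simp [hx]⟩

lemma pow_two_pow_bound {s t C : ℝ} (ht : 0 ≤ t) (h : ∀ n : ℕ, s ^ 2 ^ n ≤ C * t ^ 2 ^ n) :
    s ≤ t := by
  by_contra! hlt
  rcases ht.eq_or_lt with rfl | ht
  · have := h 0
    simp at this
    linarith
  have h1 : 1 < s / t := (one_lt_div ht).2 hlt
  obtain ⟨n, hn⟩ := pow_unbounded_of_one_lt C h1
  have h2 : (s / t) ^ n ≤ (s / t) ^ 2 ^ n := pow_le_pow_right₀ h1.le Nat.lt_two_pow_self.le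
  have h3 : (s / t) ^ 2 ^ n ≤ C := by
    rw [div_pow, div_le_iff₀ (by positivity)]
    exact h n
  linarith

lemma norm_sq_le_sum {A : Type} [NonUnitalCStarAlgebra A] {ι : Type} (F : Finset ι) (a : ι → A)
    (i : ι) (hi : i ∈ F) : ‖a i‖ ^ 2 ≤ ‖∑ j ∈ F, a j * star (a j)‖ := by
  let _ := CStarAlgebra.spectralOrder A
  have _ := CStarAlgebra.spectralOrderedRing A
  have h1 : a i * star (a i) ≤ ∑ j ∈ F, a j * star (a j) :=
    Finset.single_le_sum (f := fun j => a j * star (a j))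
      (fun j _ => mul_star_self_nonneg (a j)) hi
  have h2 := CStarAlgebra.norm_le_norm_of_nonneg_of_le (mul_star_self_nonneg (a i)) h1
  rwa [CStarRing.norm_self_mul_star, ← sq] at h2

/-- Exel: if `(π, u, H)` is a covariant representation with `π` faithful and
there is a bounded linear map `E` on the generated C*-algebra with `E(π(a)) = a` and
`E(π(d) u_g) = 0` for `g ≠ e`, then `π × u` has property (*) and `E` coincides with the
canonical conditional expectation `N` determined by `N(Σ π(a(g)) u_g) = a(e)`. -/
theorem property_star_of_expectation
    {G : Type} [Group G] {A : Type} [NonUnitalCStarAlgebra A] [NormedSpace ℂ A]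
    [IsScalarTower ℂ A A] [SMulCommClass ℂ A A] [StarModule ℂ A]
    {θ : PartialAction G A}
    {H : Type} [NormedAddCommGroup H] [InnerProductSpace ℂ H] [CompleteSpace H]
    (ρ : CovariantRep θ H) (hfaith : Function.Injective ρ.π)
    (E : ↥ρ.genAlg →L[ℂ] A)
    (hE1 : ∀ a : A, E ⟨ρ.π a, ρ.pi_mem_genAlg a⟩ = a)
    (hE2 : ∀ g : G, g ≠ 1 → ∀ d ∈ θ.D g,
      E ⟨ρ.π d * ρ.u g, mul_mem (ρ.pi_mem_genAlg d) (ρ.u_mem_genAlg g)⟩ = 0) :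
    (∀ (F : Finset G) (a : G → A), (∀ g, a g ∈ θ.D g) → (∀ g ∉ F, a g = 0) →
      ‖a 1‖ ≤ ‖∑ g ∈ F, ρ.π (a g) * ρ.u g‖) ∧
    (∀ (F : Finset G) (a : G → A), (∀ g, a g ∈ θ.D g) → (∀ g ∉ F, a g = 0) →
      ∀ hmem : (∑ g ∈ F, ρ.π (a g) * ρ.u g) ∈ ρ.genAlg,
        E ⟨∑ g ∈ F, ρ.π (a g) * ρ.u g, hmem⟩ = a 1) := by
  classical
  have hfib : ∀ g : G, g ≠ 1 → ∀ x ∈ ρ.fibre g, E x = 0 := by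
    rintro g hg ⟨x, hx⟩ ⟨d, hd, rfl⟩
    exact hE2 g hg d hd
  have key2 : ∀ (F : Finset G) (a : G → A), (∀ g, a g ∈ θ.D g) → (∀ g ∉ F, a g = 0) →
      ∀ hmem : (∑ g ∈ F, ρ.π (a g) * ρ.u g) ∈ ρ.genAlg,
        E ⟨∑ g ∈ F, ρ.π (a g) * ρ.u g, hmem⟩ = a 1 := by
    intro F a ha hF hmem
    have e : (⟨∑ g ∈ F, ρ.π (a g) * ρ.u g, hmem⟩ : ↥ρ.genAlg) = ∑ g ∈ F,
        (⟨ρ.π (a g) * ρ.u g, mul_mem (ρ.pi_mem_genAlg _) (ρ.u_mem_genAlg g)⟩ : ↥ρ.genAlg) := by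
      apply Subtype.ext
      simp
    rw [e, map_sum, Finset.sum_eq_single 1]
    · simp only [ρ.pi_u_one]
      exact hE1 _
    · intro g _ hg
      exact hE2 g hg _ (ha g)
    · intro h
      simp only [ρ.pi_u_one]
      exact (hE1 _).trans (hF 1 h)
  have hkey : ∀ x ∈ ⨆ g, ρ.fibre g, x * star x ∈ ⨆ g, ρ.fibre g ∧
      ‖E x‖ ^ 2 ≤ ‖E (x * star x)‖ := by
    intro x hx
    obtain ⟨f, hf, hsum⟩ := (Submodule.mem_iSup_iff_exists_finsupp _ _).1 hx
    choose a ha hfa using hf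
    set F : Finset G := insert 1 f.support with hFdef
    have hxF : x = ∑ g ∈ F, f g := by
      rw [← hsum, Finsupp.sum]
      apply Finset.sum_subset (Finset.subset_insert _ _)
      intro g _ hg
      simpa using hg
    have hprod : ∀ g h, f g * star (f h) ∈ ρ.fibre (g * h⁻¹) := by
      intro g h
      obtain ⟨c, hc, e⟩ := ρ.prod_form g h (a g) (a h) (ha g) (ha h)
      refine ⟨c, hc, ?_⟩
      rw [← e, ← hfa, ← hfa]
      rfl
    have hxx : x * star x = ∑ g ∈ F, ∑ h ∈ F, f g * star (f h) := by
      rw [hxF, star_sum, Finset.sum_mul_sum]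
    have hEx : E x = a 1 := by
      rw [hxF, map_sum, Finset.sum_eq_single 1]
      · have : f 1 = ⟨ρ.π (a 1), ρ.pi_mem_genAlg _⟩ := by
          apply Subtype.ext
          rw [hfa 1, ρ.pi_u_one]
        rw [this, hE1]
      · intro g _ hg
        exact hfib g hg _ ⟨a g, ha g, hfa g⟩
      · intro h
        exact absurd (Finset.mem_insert_self _ _) h
    have hExx : E (x * star x) = ∑ g ∈ F, a g * star (a g) := by
      rw [hxx, map_sum]
      refine Finset.sum_congr rfl fun g hg => ?_
      rw [map_sum, Finset.sum_eq_single g]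
      · have : f g * star (f g) = ⟨ρ.π (a g * star (a g)), ρ.pi_mem_genAlg _⟩ := by
          apply Subtype.ext
          have h := ρ.diag_form g (a g) (ha g)
          rw [← hfa] at h
          exact h
        rw [this, hE1]
      · intro h _ hne
        refine hfib _ (fun h1 => hne ?_) _ (hprod g h)
        exact (mul_inv_eq_one.1 h1).symm
      · intro h
        exact absurd hg h
    constructor
    · rw [hxx]
      exact Submodule.sum_mem _ fun g _ => Submodule.sum_mem _ fun h _ =>
        Submodule.mem_iSup_of_mem _ (hprod g h)
    · rw [hEx, hExx]
      exact norm_sq_le_sum F a 1 (Finset.mem_insert_self _ _)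
  have hiter : ∀ n : ℕ, ∀ x ∈ ⨆ g, ρ.fibre g, ‖E x‖ ^ 2 ^ n ≤ ‖E‖ * ‖x‖ ^ 2 ^ n := by
    intro n
    induction n with
    | zero =>
      intro x _
      simpa using E.le_opNorm x
    | succ n ih =>
      intro x hx
      obtain ⟨h1, h2⟩ := hkey x hx
      have h3 := ih _ h1
      have h4 : ‖x * star x‖ = ‖x‖ ^ 2 := by
        have : ‖(x : H →L[ℂ] H) * star (x : H →L[ℂ] H)‖ = ‖(x : H →L[ℂ] H)‖ ^ 2 := by
          rw [CStarRing.norm_self_mul_star, sq]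
        exact this
      rw [h4, ← pow_mul, ← pow_succ'] at h3
      calc ‖E x‖ ^ 2 ^ (n + 1) = (‖E x‖ ^ 2) ^ 2 ^ n := by rw [← pow_mul, ← pow_succ']
        _ ≤ ‖E (x * star x)‖ ^ 2 ^ n := pow_le_pow_left₀ (by positivity) h2 _
        _ ≤ _ := h3
  refine ⟨fun F a ha hF => ?_, key2⟩
  have hmem : (∑ g ∈ F, ρ.π (a g) * ρ.u g) ∈ ρ.genAlg :=
    sum_mem fun g _ => mul_mem (ρ.pi_mem_genAlg _) (ρ.u_mem_genAlg g)
  have hL : (⟨∑ g ∈ F, ρ.π (a g) * ρ.u g, hmem⟩ : ↥ρ.genAlg) ∈ ⨆ g, ρ.fibre g := by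
    have e : (⟨∑ g ∈ F, ρ.π (a g) * ρ.u g, hmem⟩ : ↥ρ.genAlg) = ∑ g ∈ F,
        (⟨ρ.π (a g) * ρ.u g, mul_mem (ρ.pi_mem_genAlg _) (ρ.u_mem_genAlg g)⟩ : ↥ρ.genAlg) := by
      apply Subtype.ext
      simp
    rw [e]
    exact Submodule.sum_mem _ fun g _ => Submodule.mem_iSup_of_mem g ⟨a g, ha g, rfl⟩
  have h := pow_two_pow_bound (norm_nonneg _) fun n => hiter n _ hL
  rw [key2 F a ha hF hmem] at h
  exact h
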